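/- arXiv:1409.8114 — 3 statements merged into one kernel-verified Lean document; each statement's English description precedes it below -/
import Mathlib

section
/- Let C and C' be cycle graphs on m ≥ 3 and m' ≥ 3 vertices respectively. For any two edges e and e' of the Cartesian (box) product C □ C', there exists a Hamiltonian cycle of C □ C' containing both e and e'. -/
open SimpleGraph

/-- A set of edges of the `m × n` torus grid, as a Boolean function: `E true i c` records whether
the edge from `(i, c)` to `(i, c + 1)` is taken and `E false i c` whether the edge from `(i, c)` to
`(i + 1, c)` is taken. It is a Hamiltonian cycle if every vertex has degree two and every
function that is constant along edges is constant. -/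
structure IsTorusCycle {m n : ℕ} (E : Bool → ZMod m → ZMod n → Bool) : Prop where
  degree : ∀ i c, (E true (i + 1) (c + 1)).toNat + (E true (i + 1) c).toNat +
    (E false (i + 1) (c + 1)).toNat + (E false i (c + 1)).toNat = 2
  connected : ∀ f : ZMod m → ZMod n → Prop,
    (∀ i c, E true i c = true → f i c = f i (c + 1)) →
    (∀ i c, E false i c = true → f i c = f (i + 1) c) → ∀ i c j d, f i c = f j d

/-- The edge set crosses between any two consecutive rows and any two consecutive columns. -/
def CrossesAll {m n : ℕ} (E : Bool → ZMod m → ZMod n → Bool) : Prop :=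
  (∀ i, ∃ c, E false i c = true) ∧ ∀ c, ∃ i, E true i c = true

/-- Any two edges of the `m × n` torus grid lie on a Hamiltonian cycle crossing between any two
consecutive rows and any two consecutive columns. -/
def TorusCovered (m n : ℕ) : Prop :=
  ∀ b₁ i₁ c₁ b₂ i₂ c₂, ∃ E : Bool → ZMod m → ZMod n → Bool,
    IsTorusCycle E ∧ CrossesAll E ∧ E b₁ i₁ c₁ = true ∧ E b₂ i₂ c₂ = true

section Symmetry

variable {m n : ℕ} {E : Bool → ZMod m → ZMod n → Bool}

lemma IsTorusCycle.translate (hE : IsTorusCycle E) (s : ZMod m) (t : ZMod n) :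
    IsTorusCycle fun b i c => E b (i + s) (c + t) where
  degree i c := by
    have := hE.degree (i + s) (c + t)
    simpa only [add_right_comm] using this
  connected f hh hv i c j d := by
    have := hE.connected (fun i c => f (i - s) (c - t))
      (fun i c h => by
        have := hh (i - s) (c - t) (by simpa using h)
        simpa only [sub_add_eq_add_sub] using this)
      (fun i c h => by
        have := hv (i - s) (c - t) (by simpa using h)
        simpa only [sub_add_eq_add_sub] using this) (i + s) (c + t) (j + s) (d + t)
    simpa using this

lemma CrossesAll.translate (hE : CrossesAll E) (s : ZMod m) (t : ZMod n) :
    CrossesAll fun b i c => E b (i + s) (c + t) := by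
  refine ⟨fun i => ?_, fun c => ?_⟩
  · obtain ⟨c, hc⟩ := hE.1 (i + s)
    exact ⟨c - t, by simpa using hc⟩
  · obtain ⟨i, hi⟩ := hE.2 (c + t)
    exact ⟨i - s, by simpa using hi⟩

lemma IsTorusCycle.swap (hE : IsTorusCycle E) : IsTorusCycle fun b c i => E (!b) i c where
  degree c i := by
    have := hE.degree i c
    simp only [Bool.not_true, Bool.not_false]
    omega
  connected f hh hv c i d j :=
    hE.connected (fun i c => f c i) (fun i c h => hv c i (by simpa using h))
      (fun i c h => hh c i (by simpa using h)) i c j d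

lemma TorusCovered.swap (h : TorusCovered m n) : TorusCovered n m := by
  intro b₁ c₁ i₁ b₂ c₂ i₂
  obtain ⟨E, hE, hc, h₁, h₂⟩ := h (!b₁) i₁ c₁ (!b₂) i₂ c₂
  exact ⟨_, hE.swap, ⟨by simpa using hc.2, by simpa using hc.1⟩, h₁, h₂⟩

end Symmetry

section SmallTori

/-- Connectivity is witnessed by a walk along the edges that visits every vertex. -/
lemma isTorusCycle_of_list {m n : ℕ} {E : Bool → ZMod m → ZMod n → Bool}
    (hdeg : ∀ i c, (E true (i + 1) (c + 1)).toNat + (E true (i + 1) c).toNat +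
      (E false (i + 1) (c + 1)).toNat + (E false i (c + 1)).toNat = 2)
    (L : List (ZMod m × ZMod n)) (hmem : ∀ i c, (i, c) ∈ L)
    (hL : L.IsChain fun p q =>
      E true p.1 p.2 = true ∧ q = (p.1, p.2 + 1) ∨ E true q.1 q.2 = true ∧ p = (q.1, q.2 + 1) ∨
      E false p.1 p.2 = true ∧ q = (p.1 + 1, p.2) ∨ E false q.1 q.2 = true ∧ p = (q.1 + 1, q.2)) :
    IsTorusCycle E where
  degree := hdeg
  connected f hh hv i c j d := by
    have hf : L.IsChain fun p q => f p.1 p.2 = f q.1 q.2 := by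
      refine hL.imp fun p q h => ?_
      rcases h with ⟨h, rfl⟩ | ⟨h, rfl⟩ | ⟨h, rfl⟩ | ⟨h, rfl⟩
      · exact hh _ _ h
      · exact (hh _ _ h).symm
      · exact hv _ _ h
      · exact (hv _ _ h).symm
    have : IsTrans (ZMod m × ZMod n) fun p q => f p.1 p.2 = f q.1 q.2 :=
      ⟨fun _ _ _ => Eq.trans⟩
    have : Std.Symm fun p q : ZMod m × ZMod n => f p.1 p.2 = f q.1 q.2 := ⟨fun _ _ => Eq.symm⟩
    exact List.Pairwise.forall_of_forall (R := fun p q : ZMod m × ZMod n => f p.1 p.2 = f q.1 q.2)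
      (fun _ _ => rfl) (List.isChain_iff_pairwise.1 hf) (hmem i c) (hmem j d)

/-- The edges of the torus grid between cyclically consecutive entries of a list of vertices. -/
def edgesOfList {m n : ℕ} (L : List (ZMod m × ZMod n)) (b : Bool) (i : ZMod m) (c : ZMod n) :
    Bool :=
  let q := if b then (i, c + 1) else (i + 1, c)
  (L.zip (L.rotate 1)).any fun p => p == ((i, c), q) || p == (q, (i, c))

/-- By translation, covering pairs with one edge at the origin suffices. -/
lemma exists_translate {m n : ℕ} {P : (Bool → ZMod m → ZMod n → Bool) → Prop}
    (hP : ∀ E s t, P E → P fun b i c => E b (i + s) (c + t))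
    (h : ∀ b₁ b₂ i c, ∃ E, P E ∧ ∃ s t, E b₁ s t = true ∧ E b₂ (i + s) (c + t) = true)
    (b₁ : Bool) (i₁ : ZMod m) (c₁ : ZMod n) (b₂ : Bool) (i₂ : ZMod m) (c₂ : ZMod n) :
    ∃ E, P E ∧ E b₁ i₁ c₁ = true ∧ E b₂ i₂ c₂ = true := by
  obtain ⟨E, hE, s, t, h₁, h₂⟩ := h b₁ b₂ (i₂ - i₁) (c₂ - c₁)
  refine ⟨_, hP E (s - i₁) (t - c₁) hE, by simpa using h₁, ?_⟩
  convert h₂ using 2 <;> ring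

lemma exists_isTorusCycle_three_three (b₁ : Bool) (i₁ c₁ : ZMod 3) (b₂ : Bool) (i₂ c₂ : ZMod 3) :
    ∃ E : Bool → ZMod 3 → ZMod 3 → Bool,
      IsTorusCycle E ∧ E b₁ i₁ c₁ = true ∧ E b₂ i₂ c₂ = true := by
  refine exists_translate (fun E s t hE => hE.translate s t) (fun b₁ b₂ i c => ?_) b₁ i₁ c₁ b₂ i₂ c₂
  let L : List (ZMod 3 × ZMod 3) :=
    [(0, 0), (0, 2), (1, 2), (2, 2), (2, 1), (2, 0), (1, 0), (1, 1), (0, 1)]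
  refine ⟨edgesOfList L, isTorusCycle_of_list (by decide +kernel) L (by decide +kernel)
    (by decide +kernel), ?_⟩
  revert b₁ b₂ i c
  decide +kernel

lemma torusCovered_of_small {m n : ℕ}
    (h : ∀ b₁ b₂ i c, ∃ E : Bool → ZMod m → ZMod n → Bool, (IsTorusCycle E ∧ CrossesAll E) ∧
      ∃ s t, E b₁ s t = true ∧ E b₂ (i + s) (c + t) = true) : TorusCovered m n := by
  intro b₁ i₁ c₁ b₂ i₂ c₂
  obtain ⟨E, hE, h⟩ := exists_translate
    (fun E s t hE => ⟨hE.1.translate s t, hE.2.translate s t⟩) h b₁ i₁ c₁ b₂ i₂ c₂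
  exact ⟨E, hE.1, hE.2, h⟩

lemma torusCovered_three_four : TorusCovered 3 4 := by
  refine torusCovered_of_small fun b₁ b₂ i c => ?_
  let L₁ : List (ZMod 3 × ZMod 4) :=
    [(0, 0), (0, 3), (2, 3), (2, 0), (1, 0), (1, 3), (1, 2), (0, 2), (2, 2), (2, 1), (1, 1), (0, 1)]
  let L₂ : List (ZMod 3 × ZMod 4) :=
    [(0, 0), (0, 1), (2, 1), (1, 1), (1, 2), (0, 2), (2, 2), (2, 3), (0, 3), (1, 3), (1, 0), (2, 0)]
  have h₁ : IsTorusCycle (edgesOfList L₁) ∧ CrossesAll (edgesOfList L₁) :=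
    ⟨isTorusCycle_of_list (by decide +kernel) L₁ (by decide +kernel) (by decide +kernel),
      by unfold CrossesAll; decide +kernel⟩
  have h₂ : IsTorusCycle (edgesOfList L₂) ∧ CrossesAll (edgesOfList L₂) :=
    ⟨isTorusCycle_of_list (by decide +kernel) L₂ (by decide +kernel) (by decide +kernel),
      by unfold CrossesAll; decide +kernel⟩
  have h : (∃ s t, edgesOfList L₁ b₁ s t = true ∧ edgesOfList L₁ b₂ (i + s) (c + t) = true) ∨
      ∃ s t, edgesOfList L₂ b₁ s t = true ∧ edgesOfList L₂ b₂ (i + s) (c + t) = true := by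
    revert b₁ b₂ i c
    decide +kernel
  exact h.elim (fun h => ⟨_, h₁, h⟩) fun h => ⟨_, h₂, h⟩

lemma torusCovered_four_four : TorusCovered 4 4 := by
  refine torusCovered_of_small fun b₁ b₂ i c => ?_
  let L : List (ZMod 4 × ZMod 4) :=
    [(0, 0), (0, 1), (0, 2), (0, 3), (3, 3), (3, 0), (3, 1), (3, 2), (2, 2), (1, 2), (1, 1), (2, 1),
      (2, 0), (2, 3), (1, 3), (1, 0)]
  refine ⟨edgesOfList L, ⟨isTorusCycle_of_list (by decide +kernel) L (by decide +kernel)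
    (by decide +kernel), by unfold CrossesAll; decide +kernel⟩, ?_⟩
  revert b₁ b₂ i c
  decide +kernel

lemma torusCovered_three_five : TorusCovered 3 5 := by
  refine torusCovered_of_small fun b₁ b₂ i c => ?_
  let L : List (ZMod 3 × ZMod 5) :=
    [(0, 0), (2, 0), (1, 0), (1, 1), (1, 2), (2, 2), (2, 1), (0, 1), (0, 2), (0, 3), (1, 3), (2, 3),
      (2, 4), (1, 4), (0, 4)]
  refine ⟨edgesOfList L, ⟨isTorusCycle_of_list (by decide +kernel) L (by decide +kernel)
    (by decide +kernel), by unfold CrossesAll; decide +kernel⟩, ?_⟩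
  revert b₁ b₂ i c
  decide +kernel

end SmallTori

section Insertion

lemma ZMod.exists_natCast_lt {m : ℕ} [NeZero m] (i : ZMod m) : ∃ k < m, (k : ZMod m) = i :=
  ⟨i.val, i.val_lt, i.natCast_zmod_val⟩

variable {m n : ℕ}

/-- Inserts two rows between the last row and the first row of the torus grid. A column in which
the given edge set joins these rows is followed, in the new rows, by the detour that covers all
columns up to the next such one. -/
def insertRows (E : Bool → ZMod m → ZMod n → Bool) :
    Bool → ZMod (m + 2) → ZMod n → Bool
  | true, i, c => if i.val < m then E true i.val c else !E false (-1) (c + 1)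
  | false, i, c =>
    if i.val < m then E false i.val c else E false (-1) (if i.val = m then c + 1 else c)

variable {E : Bool → ZMod m → ZMod n → Bool}

lemma insertRows_of_lt (b : Bool) {k : ℕ} (hk : k < m) (c : ZMod n) :
    insertRows E b k c = E b k c := by
  have : (k : ZMod (m + 2)).val = k := ZMod.val_natCast_of_lt (by omega)
  cases b <;> simp [insertRows, this, hk]

lemma insertRows_true_of_le {k : ℕ} (hk : m ≤ k) (hk' : k < m + 2) (c : ZMod n) :
    insertRows E true k c = !E false (-1) (c + 1) := by
  have : (k : ZMod (m + 2)).val = k := ZMod.val_natCast_of_lt hk'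
  simp [insertRows, this, hk.not_gt]

lemma insertRows_false_self (c : ZMod n) :
    insertRows E false (m : ℕ) c = E false (-1) (c + 1) := by
  have : (m : ZMod (m + 2)).val = m := ZMod.val_natCast_of_lt (by omega)
  simp [insertRows, this]

lemma insertRows_false_succ (c : ZMod n) :
    insertRows E false (m + 1 : ℕ) c = E false (-1) c := by
  have : ((m + 1 : ℕ) : ZMod (m + 2)).val = m + 1 := ZMod.val_natCast_of_lt (by omega)
  simp only [insertRows, this]
  simp

lemma ZMod.natCast_eq_neg_one_of_succ_eq {k : ℕ} (h : k + 1 = m) : (k : ZMod m) = -1 := by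
  rw [eq_neg_iff_add_eq_zero]
  exact_mod_cast (ZMod.natCast_eq_zero_iff _ _).2 (dvd_of_eq h.symm)

lemma insertRows_degree (hE : IsTorusCycle E) [NeZero m] (i : ZMod (m + 2)) (c : ZMod n) :
    (insertRows E true (i + 1) (c + 1)).toNat + (insertRows E true (i + 1) c).toNat +
      (insertRows E false (i + 1) (c + 1)).toNat + (insertRows E false i (c + 1)).toNat = 2 := by
  obtain ⟨k, hk, rfl⟩ := ZMod.exists_natCast_lt i
  have hm : 0 < m := Nat.pos_of_ne_zero (NeZero.ne m)
  rcases Nat.lt_trichotomy (k + 1) m with h | h | h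
  · rw [← Nat.cast_succ, insertRows_of_lt _ h, insertRows_of_lt _ h, insertRows_of_lt _ h,
      insertRows_of_lt _ (by omega)]
    have := hE.degree k c
    rwa [← Nat.cast_succ] at this
  · rw [← Nat.cast_succ, Nat.succ_eq_add_one, insertRows_of_lt (k := k) _ (by omega),
      ZMod.natCast_eq_neg_one_of_succ_eq h, h,
      insertRows_true_of_le le_rfl (by omega), insertRows_true_of_le le_rfl (by omega),
      insertRows_false_self]
    cases E false (-1) (c + 1) <;> cases E false (-1) (c + 1 + 1) <;> rfl
  · obtain rfl | rfl : k = m ∨ k = m + 1 := by omega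
    · rw [← Nat.cast_succ, Nat.succ_eq_add_one, insertRows_true_of_le (by omega) (by omega),
        insertRows_true_of_le (by omega) (by omega), insertRows_false_succ, insertRows_false_self]
      cases E false (-1) (c + 1) <;> cases E false (-1) (c + 1 + 1) <;> rfl
    · have h0 : ((m + 1 : ℕ) : ZMod (m + 2)) + 1 = (0 : ℕ) := by
        rw [ZMod.natCast_eq_neg_one_of_succ_eq rfl]; simp
      rw [h0, insertRows_of_lt _ hm, insertRows_of_lt _ hm, insertRows_of_lt _ hm,
        insertRows_false_succ]
      have := hE.degree (-1) c
      simpa using this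

lemma insertRows_connected (hE : IsTorusCycle E) [NeZero m] [NeZero n]
    (hK : ∃ c, E false (-1) c = true) (f : ZMod (m + 2) → ZMod n → Prop)
    (hh : ∀ i c, insertRows E true i c = true → f i c = f i (c + 1))
    (hv : ∀ i c, insertRows E false i c = true → f i c = f (i + 1) c)
    (i : ZMod (m + 2)) (c : ZMod n) (j : ZMod (m + 2)) (d : ZMod n) : f i c = f j d := by
  obtain ⟨c₀, hc₀⟩ := hK
  have hm : 0 < m := Nat.pos_of_ne_zero (NeZero.ne m)
  have hnew : ∀ c, f (m : ℕ) c = f (m + 1 : ℕ) c := by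
    have key : ∀ (t : ℕ) (c : ZMod n), c + 1 + t = c₀ → f (m : ℕ) c = f (m + 1 : ℕ) c := by
      intro t
      induction t with
      | zero =>
        intro c hc
        have := hv (m : ℕ) c (by rw [insertRows_false_self]; simpa [← hc] using hc₀)
        rwa [← Nat.cast_succ] at this
      | succ t ih =>
        intro c hc
        by_cases h : E false (-1) (c + 1) = true
        · have := hv (m : ℕ) c (by rw [insertRows_false_self, h])
          rwa [← Nat.cast_succ] at this
        · rw [hh (m : ℕ) c (by rw [insertRows_true_of_le le_rfl (by omega)]; simpa using h),
            hh (m + 1 : ℕ) c (by rw [insertRows_true_of_le (by omega) (by omega)]; simpa using h)]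
          exact ih _ (by rw [← hc]; push_cast; ring)
    intro c
    obtain ⟨t, -, ht⟩ := ZMod.exists_natCast_lt (c₀ - (c + 1))
    exact key t c (by rw [ht]; ring)
  have hlast : ∀ c, E false (-1) c = true → f (m - 1 : ℕ) c = f (m : ℕ) c := by
    intro c hc
    have := hv (m - 1 : ℕ) c (by
      rw [insertRows_of_lt _ (by omega), ZMod.natCast_eq_neg_one_of_succ_eq (by omega), hc])
    rwa [← Nat.cast_succ, Nat.succ_eq_add_one, Nat.sub_add_cancel hm] at this
  have hfirst : ∀ c, E false (-1) c = true → f (m + 1 : ℕ) c = f (0 : ℕ) c := by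
    intro c hc
    have := hv (m + 1 : ℕ) c (by rw [insertRows_false_succ, hc])
    rwa [ZMod.natCast_eq_neg_one_of_succ_eq rfl, neg_add_cancel, ← Nat.cast_zero,
      ← ZMod.natCast_eq_neg_one_of_succ_eq rfl] at this
  have hold : ∀ k < m, ∀ c, ∀ l < m, ∀ d, f (k : ℕ) c = f (l : ℕ) d := by
    intro k hk c l hl d
    have := hE.connected (fun i c => f (i.val : ℕ) c)
      (fun i c h => hh _ _ (by rw [insertRows_of_lt _ i.val_lt, i.natCast_zmod_val, h]))
      (fun i c h => by
        obtain ⟨k, hk, rfl⟩ := ZMod.exists_natCast_lt i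
        rcases (show k + 1 ≤ m from hk).lt_or_eq with h' | h'
        · have := hv k c (by rw [insertRows_of_lt _ hk, h])
          rw [← Nat.cast_succ, ZMod.val_natCast_of_lt h', ZMod.val_natCast_of_lt hk, this,
            Nat.cast_succ]
        · rw [ZMod.val_natCast_of_lt hk]
          rw [ZMod.natCast_eq_neg_one_of_succ_eq h'] at h ⊢
          rw [neg_add_cancel, ZMod.val_zero, ← hfirst c h, ← hnew, ← hlast c h,
            show m - 1 = k by omega])
      k c l d
    simpa [ZMod.val_natCast_of_lt hk, ZMod.val_natCast_of_lt hl] using this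
  have hrow : ∀ c, f (m : ℕ) c = f (0 : ℕ) c₀ := by
    have key : ∀ t : ℕ, f (m : ℕ) (c₀ + t) = f (0 : ℕ) c₀ := by
      intro t
      induction t with
      | zero => rw [hnew]; simpa using hfirst c₀ hc₀
      | succ t ih =>
        by_cases h : E false (-1) (c₀ + (t + 1 : ℕ)) = true
        · rw [hnew, hfirst _ h]
          exact hold 0 hm _ 0 hm _
        · rw [← ih, hh (m : ℕ) (c₀ + t) (by
            rw [insertRows_true_of_le le_rfl (by omega)]
            simpa [add_assoc] using h)]
          push_cast
          rw [add_assoc]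
    intro c
    obtain ⟨t, -, ht⟩ := ZMod.exists_natCast_lt (c - c₀)
    simpa [ht] using key t
  have hall : ∀ i c, f i c = f (0 : ℕ) c₀ := by
    intro i c
    obtain ⟨k, hk, rfl⟩ := ZMod.exists_natCast_lt i
    obtain h | rfl | rfl : k < m ∨ k = m ∨ k = m + 1 := by omega
    · exact hold k h c 0 hm c₀
    · exact hrow c
    · rw [← hnew, hrow]
  rw [hall i c, hall j d]

lemma IsTorusCycle.insertRows (hE : IsTorusCycle E) [NeZero m] [NeZero n]
    (hK : ∃ c, E false (-1) c = true) : IsTorusCycle (insertRows E) :=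
  ⟨insertRows_degree hE, insertRows_connected hE hK⟩

lemma CrossesAll.insertRows (hE : CrossesAll E) [NeZero m] : CrossesAll (insertRows E) := by
  refine ⟨fun i => ?_, fun c => ?_⟩
  · obtain ⟨k, hk, rfl⟩ := ZMod.exists_natCast_lt i
    obtain ⟨c, hc⟩ := hE.1 (-1)
    obtain h | rfl | rfl : k < m ∨ k = m ∨ k = m + 1 := by omega
    · obtain ⟨d, hd⟩ := hE.1 k
      exact ⟨d, by rw [insertRows_of_lt _ h, hd]⟩
    · exact ⟨c - 1, by rw [insertRows_false_self, sub_add_cancel, hc]⟩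
    · exact ⟨c, by rw [insertRows_false_succ, hc]⟩
  · obtain ⟨i, hi⟩ := hE.2 c
    obtain ⟨k, hk, rfl⟩ := ZMod.exists_natCast_lt i
    exact ⟨k, by rw [insertRows_of_lt _ hk, hi]⟩

/-- An edge that is neither horizontal in one of the two inserted rows nor vertical between them
comes from an edge of the smaller torus grid. -/
lemma exists_insertRows_eq [NeZero m] (b : Bool) (i : ZMod (m + 2)) (c : ZMod n)
    (hi : i ≠ m) (hi' : b = true → i ≠ (m + 1 : ℕ)) :
    ∃ j : ZMod m, ∀ E : Bool → ZMod m → ZMod n → Bool, insertRows E b i c = E b j c := by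
  obtain ⟨k, hk, rfl⟩ := ZMod.exists_natCast_lt i
  obtain h | rfl | rfl : k < m ∨ k = m ∨ k = m + 1 := by omega
  · exact ⟨k, fun E => insertRows_of_lt b h c⟩
  · exact absurd rfl hi
  · cases b
    · exact ⟨-1, fun E => insertRows_false_succ c⟩
    · exact absurd rfl (hi' rfl)

lemma TorusCovered.add_two [NeZero n] (hm : 3 ≤ m) (h : TorusCovered m n) :
    TorusCovered (m + 2) n := by
  have : NeZero m := ⟨by omega⟩
  intro b₁ i₁ c₁ b₂ i₂ c₂
  obtain ⟨s, hs⟩ : ∃ s : ZMod (m + 2), s ∉ ({m - i₁, (m + 1 : ℕ) - i₁, m - i₂,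
      (m + 1 : ℕ) - i₂} : Finset (ZMod (m + 2))) := by
    by_contra! hs
    have h1 := Finset.card_le_card (fun x _ => hs x : (Finset.univ : Finset (ZMod (m + 2))) ⊆ _)
    rw [Finset.card_univ, ZMod.card] at h1
    exact absurd (h1.trans Finset.card_le_four) (by omega)
  simp only [Finset.mem_insert, Finset.mem_singleton, not_or, eq_sub_iff_add_eq'] at hs
  obtain ⟨j₁, hj₁⟩ := exists_insertRows_eq b₁ (i₁ + s) c₁ hs.1 fun _ => hs.2.1
  obtain ⟨j₂, hj₂⟩ := exists_insertRows_eq b₂ (i₂ + s) c₂ hs.2.2.1 fun _ => hs.2.2.2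
  obtain ⟨E, hE, hE', h₁, h₂⟩ := h b₁ j₁ c₁ b₂ j₂ c₂
  exact ⟨_, (hE.insertRows (hE'.1 _)).translate s 0, hE'.insertRows.translate s 0,
    by simpa [hj₁] using h₁, by simpa [hj₂] using h₂⟩

lemma TorusCovered.of_le [NeZero n] {k : ℕ} (hk : 3 ≤ k) (h : TorusCovered k n)
    (h' : TorusCovered (k + 1) n) (hm : k ≤ m) : TorusCovered m n := by
  induction m using Nat.strong_induction_on with
  | _ m ih =>
    obtain rfl | rfl | hm' : m = k ∨ m = k + 1 ∨ k + 2 ≤ m := by omega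
    · exact h
    · exact h'
    · obtain ⟨l, rfl⟩ : ∃ l, m = l + 2 := ⟨m - 2, by omega⟩
      exact (ih l (by omega) (by omega)).add_two (by omega)

/-- The `3 × 3` torus is the only one excluded. -/
lemma torusCovered (hm : 3 ≤ m) (hn : 3 ≤ n) (h : ¬(m = 3 ∧ n = 3)) : TorusCovered m n := by
  have three_right : ∀ {k}, 4 ≤ k → TorusCovered k 3 :=
    TorusCovered.of_le (by omega) torusCovered_three_four.swap torusCovered_three_five.swap
  have : NeZero n := ⟨by omega⟩
  obtain rfl | hn' : n = 3 ∨ 4 ≤ n := by omega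
  · exact three_right (by omega)
  · have four_right : ∀ {k}, 3 ≤ k → TorusCovered k 4 :=
      TorusCovered.of_le le_rfl torusCovered_three_four torusCovered_four_four
    exact .of_le le_rfl (three_right hn').swap (four_right hn).swap hm

lemma exists_isTorusCycle (hm : 3 ≤ m) (hn : 3 ≤ n) (b₁ : Bool) (i₁ : ZMod m) (c₁ : ZMod n)
    (b₂ : Bool) (i₂ : ZMod m) (c₂ : ZMod n) :
    ∃ E : Bool → ZMod m → ZMod n → Bool,
      IsTorusCycle E ∧ E b₁ i₁ c₁ = true ∧ E b₂ i₂ c₂ = true := by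
  by_cases h : m = 3 ∧ n = 3
  · obtain ⟨rfl, rfl⟩ := h
    exact exists_isTorusCycle_three_three b₁ i₁ c₁ b₂ i₂ c₂
  · obtain ⟨E, hE, -, h⟩ := torusCovered hm hn h b₁ i₁ c₁ b₂ i₂ c₂
    exact ⟨E, hE, h⟩

end Insertion

section Walks

variable {V : Type*}

lemma SimpleGraph.IsCycles.exists_isHamiltonianCycle [Finite V] [DecidableEq V]
    {G : SimpleGraph V} (hG : G.IsCycles) (hconn : G.Connected) {v w : V} (hvw : G.Adj v w) :
    ∃ p : G.Walk v v, p.IsHamiltonianCycle ∧ p.toSubgraph.verts = Set.univ ∧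
      ∀ x y, p.toSubgraph.Adj x y ↔ G.Adj x y := by
  classical
  have := Fintype.ofFinite V
  obtain ⟨p, hp, hverts⟩ := hG.exists_cycle_toSubgraph_verts_eq_connectedComponentSupp
    (c := G.connectedComponentMk v) rfl ⟨w, hvw⟩
  have huniv : p.toSubgraph.verts = Set.univ := by
    rw [hverts, Set.eq_univ_iff_forall]
    exact fun x => ConnectedComponent.sound (hconn.preconnected x v)
  refine ⟨p, ⟨hp, hp.isPath_tail.isHamiltonian_of_mem fun x => ?_⟩, huniv, fun x y => ?_⟩
  · have hx : x ∈ p.support := by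
      rw [← Walk.mem_verts_toSubgraph, huniv]
      trivial
    rw [← Walk.cons_tail_support, List.mem_cons, ← p.support_tail_of_not_nil hp.not_nil] at hx
    obtain rfl | hx := hx
    · exact p.tail.end_mem_support
    · exact hx
  · exact hp.adj_toSubgraph_iff_of_isCycles hG (huniv ▸ Set.mem_univ x) y

/-- The vertices of a cycle graph can be enumerated cyclically by `ZMod m`. -/
lemma SimpleGraph.exists_bijective_zmod [Fintype V] [DecidableEq V] (C : SimpleGraph V)
    [DecidableRel C.Adj] {m : ℕ} [NeZero m] (hcard : Fintype.card V = m) (hconn : C.Connected)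
    (hreg : ∀ v, C.degree v = 2) :
    ∃ φ : ZMod m → V, Function.Bijective φ ∧ (∀ i, C.Adj (φ i) (φ (i + 1))) ∧
      ∀ a b, C.Adj a b → ∃ i, s(φ i, φ (i + 1)) = s(a, b) := by
  have hcyc : C.IsCycles := fun v _ => by
    rw [← hreg v, ← C.card_neighborSet_eq_degree v, Set.ncard_eq_toFinset_card', Set.toFinset_card]
  obtain ⟨v⟩ := hconn.nonempty
  obtain ⟨w, hw⟩ := (C.degree_pos_iff_exists_adj v).1 (by rw [hreg v]; omega)
  obtain ⟨p, hp, hverts, hadj⟩ := hcyc.exists_isHamiltonianCycle hconn hw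
  have hlen : p.length = m := by rw [hp.length_eq, hcard]
  have hval : ∀ k ≤ m, p.getVert (k : ZMod m).val = p.getVert k := by
    intro k hk
    obtain rfl | hk := hk.eq_or_lt
    · simp [← hlen]
    · rw [ZMod.val_natCast_of_lt hk]
  refine ⟨fun i => p.getVert i.val, ?_, fun i => ?_, fun a b hab => ?_⟩
  · refine (Fintype.bijective_iff_surjective_and_card _).2 ⟨fun a => ?_, by rw [ZMod.card, hcard]⟩
    obtain ⟨k, hk, hkl⟩ := Walk.mem_support_iff_exists_getVert.1
      (p.mem_verts_toSubgraph.1 (hverts ▸ Set.mem_univ a))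
    exact ⟨k, by rw [← hk]; exact hval k (by omega)⟩
  · obtain ⟨k, hk, rfl⟩ := ZMod.exists_natCast_lt i
    rw [← Nat.cast_succ]
    simp only
    rw [hval k hk.le, hval _ hk]
    exact p.adj_getVert_succ (by omega)
  · obtain ⟨k, hk, hkl⟩ := (p.toSubgraph_adj_iff).1 ((hadj a b).2 hab)
    refine ⟨k, ?_⟩
    rw [← Nat.cast_succ]
    simp only
    rw [hval k (by omega), hval _ (by omega), ← hk]

end Walks

section TorusGraph

variable {m n : ℕ}

/-- The graph formed by a set of edges of the torus grid. -/
def torusGraph (E : Bool → ZMod m → ZMod n → Bool) : SimpleGraph (ZMod m × ZMod n) :=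
  .fromRel fun p q =>
    E true p.1 p.2 = true ∧ q = (p.1, p.2 + 1) ∨ E false p.1 p.2 = true ∧ q = (p.1 + 1, p.2)

variable {E : Bool → ZMod m → ZMod n → Bool}

lemma torusGraph_adj_true (hn : 3 ≤ n) {i : ZMod m} {c : ZMod n} (h : E true i c = true) :
    (torusGraph E).Adj (i, c) (i, c + 1) := by
  have : Fact (1 < n) := ⟨by omega⟩
  simp [torusGraph, h]

lemma torusGraph_adj_false (hm : 3 ≤ m) {i : ZMod m} {c : ZMod n} (h : E false i c = true) :
    (torusGraph E).Adj (i, c) (i + 1, c) := by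
  have : Fact (1 < m) := ⟨by omega⟩
  simp [torusGraph, h]

lemma ncard_eq_two_of_toNat {X : Type*} {a b c d : X} (hab : a ≠ b) (hac : a ≠ c) (had : a ≠ d)
    (hbc : b ≠ c) (hbd : b ≠ d) (hcd : c ≠ d) {p q r s : Bool}
    (h : p.toNat + q.toNat + r.toNat + s.toNat = 2) :
    {x | p = true ∧ x = a ∨ q = true ∧ x = b ∨ r = true ∧ x = c ∨ s = true ∧ x = d}.ncard = 2 := by
  rw [Set.ncard_eq_two]
  cases p <;> cases q <;> cases r <;> cases s <;> simp at h
  · exact ⟨c, d, hcd, by ext; simp⟩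
  · exact ⟨b, d, hbd, by ext; simp⟩
  · exact ⟨b, c, hbc, by ext; simp⟩
  · exact ⟨a, d, had, by ext; simp⟩
  · exact ⟨a, c, hac, by ext; simp⟩
  · exact ⟨a, b, hab, by ext; simp⟩

lemma ZMod.one_add_one_ne_zero (hm : 3 ≤ m) : (1 : ZMod m) + 1 ≠ 0 := by
  have h : ((2 : ℕ) : ZMod m) ≠ 0 := by
    rw [Ne, ZMod.natCast_eq_zero_iff]
    exact fun h => absurd (Nat.le_of_dvd two_pos h) (by omega)
  rwa [Nat.cast_two, ← one_add_one_eq_two] at h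

lemma IsTorusCycle.isCycles (hE : IsTorusCycle E) (hm : 3 ≤ m) (hn : 3 ≤ n) :
    (torusGraph E).IsCycles := by
  rintro ⟨i, c⟩ -
  obtain ⟨i, rfl⟩ : ∃ j, i = j + 1 := ⟨i - 1, by ring⟩
  obtain ⟨c, rfl⟩ : ∃ d, c = d + 1 := ⟨c - 1, by ring⟩
  have : Fact (1 < m) := ⟨by omega⟩
  have : Fact (1 < n) := ⟨by omega⟩
  have hm2 := ZMod.one_add_one_ne_zero hm
  have hn2 := ZMod.one_add_one_ne_zero hn
  have := ncard_eq_two_of_toNat (a := (i + 1, c + 1 + 1)) (b := (i + 1, c))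
    (c := (i + 1 + 1, c + 1)) (d := (i, c + 1)) (by simp [add_assoc, hn2]) (by simp) (by simp)
    (by simp) (by simp) (by simp [add_assoc, hm2]) (hE.degree i c)
  rw [← this]
  congr 1
  ext ⟨j, d⟩
  simp only [mem_neighborSet, torusGraph, fromRel_adj, Set.mem_ofPred_eq, Prod.mk.injEq,
    add_left_inj]
  constructor
  · rintro ⟨-, (⟨h, rfl, rfl⟩ | ⟨h, rfl, rfl⟩) | (⟨h, rfl, rfl⟩ | ⟨h, rfl, rfl⟩)⟩ <;> simp [h]
  · rintro (⟨h, rfl, rfl⟩ | ⟨h, rfl, rfl⟩ | ⟨h, rfl, rfl⟩ | ⟨h, rfl, rfl⟩) <;> simp [h]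

lemma IsTorusCycle.torusGraph_connected (hE : IsTorusCycle E) (hm : 3 ≤ m) (hn : 3 ≤ n) :
    (torusGraph E).Connected := by
  refine ⟨fun p q => ?_⟩
  have := hE.connected (fun i c => (torusGraph E).Reachable p (i, c))
    (fun i c h => propext ⟨fun h' => h'.trans (torusGraph_adj_true hn h).reachable,
      fun h' => h'.trans (torusGraph_adj_true hn h).symm.reachable⟩)
    (fun i c h => propext ⟨fun h' => h'.trans (torusGraph_adj_false hm h).reachable,
      fun h' => h'.trans (torusGraph_adj_false hm h).symm.reachable⟩) p.1 p.2 q.1 q.2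
  exact this.mp (Reachable.refl p)

lemma torusGraph_adj_map {α β : Type*} {C : SimpleGraph α} {C' : SimpleGraph β}
    {φ : ZMod m → α} {ψ : ZMod n → β} (hφ : ∀ i, C.Adj (φ i) (φ (i + 1)))
    (hψ : ∀ c, C'.Adj (ψ c) (ψ (c + 1))) {p q : ZMod m × ZMod n} (h : (torusGraph E).Adj p q) :
    (C □ C').Adj (Prod.map φ ψ p) (Prod.map φ ψ q) := by
  obtain ⟨i, c⟩ := p
  obtain ⟨j, d⟩ := q
  simp only [torusGraph, fromRel_adj, Prod.mk.injEq] at h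
  rcases h with ⟨-, (⟨-, rfl, rfl⟩ | ⟨-, rfl, rfl⟩) | (⟨-, rfl, rfl⟩ | ⟨-, rfl, rfl⟩)⟩
  · simp [boxProd_adj, hψ]
  · simp [boxProd_adj, hφ]
  · simp [boxProd_adj, (hψ _).symm]
  · simp [boxProd_adj, (hφ _).symm]

/-- The edge of the torus grid encoded by a direction and an initial vertex. -/
def torusEdge (b : Bool) (i : ZMod m) (c : ZMod n) : Sym2 (ZMod m × ZMod n) :=
  s((i, c), if b then (i, c + 1) else (i + 1, c))

lemma torusEdge_mem_edgeSet (hm : 3 ≤ m) (hn : 3 ≤ n) {b : Bool} {i : ZMod m} {c : ZMod n}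
    (h : E b i c = true) : torusEdge b i c ∈ (torusGraph E).edgeSet := by
  cases b
  · exact torusGraph_adj_false hm h
  · exact torusGraph_adj_true hn h

lemma exists_torusEdge_map_eq {α β : Type*} {C : SimpleGraph α} {C' : SimpleGraph β}
    {φ : ZMod m → α} {ψ : ZMod n → β} (hφ : Function.Surjective φ) (hψ : Function.Surjective ψ)
    (hC : ∀ a b, C.Adj a b → ∃ i, s(φ i, φ (i + 1)) = s(a, b))
    (hC' : ∀ a b, C'.Adj a b → ∃ i, s(ψ i, ψ (i + 1)) = s(a, b))
    {e : Sym2 (α × β)} (he : e ∈ (C □ C').edgeSet) :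
    ∃ b i c, (torusEdge b i c).map (Prod.map φ ψ) = e := by
  induction e using Sym2.ind with
  | _ x y =>
    obtain ⟨a, b⟩ := x
    obtain ⟨a', b'⟩ := y
    rw [mem_edgeSet, boxProd_adj] at he
    simp only at he
    rcases he with ⟨h, rfl⟩ | ⟨h, rfl⟩
    · obtain ⟨i, hi⟩ := hC _ _ h
      obtain ⟨c, rfl⟩ := hψ b
      refine ⟨false, i, c, ?_⟩
      simpa [torusEdge] using hi
    · obtain ⟨c, hc⟩ := hC' _ _ h
      obtain ⟨i, rfl⟩ := hφ a
      refine ⟨true, i, c, ?_⟩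
      simpa [torusEdge] using hc

end TorusGraph

/-- For cycle graphs `C` and `C'` (connected 2-regular graphs) on
`m ≥ 3` and `m' ≥ 3` vertices, any two edges of the box product `C □ C'` are contained
in a common Hamiltonian cycle. -/
theorem boxProd_cycles_hamiltonian {α β : Type*} [Fintype α] [Fintype β]
    [DecidableEq α] [DecidableEq β]
    (C : SimpleGraph α) (C' : SimpleGraph β) [DecidableRel C.Adj] [DecidableRel C'.Adj]
    (m m' : ℕ) (hm : 3 ≤ m) (hm' : 3 ≤ m')
    (hcard : Fintype.card α = m) (hcard' : Fintype.card β = m')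
    (hconn : C.Connected) (hreg : ∀ v, C.degree v = 2)
    (hconn' : C'.Connected) (hreg' : ∀ v, C'.degree v = 2)
    (e e' : Sym2 (α × β)) (he : e ∈ (C □ C').edgeSet) (he' : e' ∈ (C □ C').edgeSet) :
    ∃ (a : α × β) (p : (C □ C').Walk a a),
      p.IsHamiltonianCycle ∧ e ∈ p.edges ∧ e' ∈ p.edges := by
  subst hcard hcard'
  have : NeZero (Fintype.card α) := ⟨by omega⟩
  have : NeZero (Fintype.card β) := ⟨by omega⟩
  obtain ⟨φ, hφ, hφadj, hφC⟩ := C.exists_bijective_zmod rfl hconn hreg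
  obtain ⟨ψ, hψ, hψadj, hψC⟩ := C'.exists_bijective_zmod rfl hconn' hreg'
  obtain ⟨b₁, i₁, c₁, rfl⟩ := exists_torusEdge_map_eq hφ.2 hψ.2 hφC hψC he
  obtain ⟨b₂, i₂, c₂, rfl⟩ := exists_torusEdge_map_eq hφ.2 hψ.2 hφC hψC he'
  obtain ⟨E, hE, h₁, h₂⟩ := exists_isTorusCycle hm hm' b₁ i₁ c₁ b₂ i₂ c₂
  have hmem₁ := torusEdge_mem_edgeSet hm hm' h₁
  have hmem₂ := torusEdge_mem_edgeSet hm hm' h₂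
  obtain ⟨p, hp, -, hadj⟩ := (hE.isCycles hm hm').exists_isHamiltonianCycle
    (hE.torusGraph_connected hm hm') hmem₁
  have hedges : ∀ e ∈ (torusGraph E).edgeSet, e ∈ p.edges := by
    intro e he
    induction e using Sym2.ind with
    | _ x y => exact Walk.adj_toSubgraph_iff_mem_edges.1 ((hadj x y).2 he)
  let f : torusGraph E →g C □ C' := ⟨Prod.map φ ψ, torusGraph_adj_map hφadj hψadj⟩
  refine ⟨_, p.map f, hp.map (f := f) (hφ.prodMap hψ), ?_, ?_⟩ <;> rw [Walk.edges_map]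
  · exact List.mem_map_of_mem (hedges _ hmem₁)
  · exact List.mem_map_of_mem (hedges _ hmem₂)
end

section
/- Let C be a cycle graph on m ≥ 3 vertices and let K_2 be the complete graph on two vertices 0, 1. Call an edge of C □ K_2 vertical if it is of the form {(v,0),(v,1)} for a vertex v of C. Let e and e' be two edges of C □ K_2 and assume that at least one of the following holds: (1) e and e' are not both vertical; (2) e = {(v,0),(v,1)} and e' = {(v',0),(v',1)} where {v, v'} is an edge of C; (3) m is even. Then there exists a Hamiltonian cycle of C □ K_2 containing both e and e'. -/
open SimpleGraph

namespace SimpleGraph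

variable {α : Type*} [DecidableEq α] {G : SimpleGraph α}

/-- In a finite connected 2-regular graph, every edge is closed up to a Hamiltonian cycle by a
Hamiltonian path through all the other edges. -/
lemma exists_isHamiltonian_of_adj [Fintype α] [DecidableRel G.Adj] (hconn : G.Connected)
    (hreg : ∀ v, G.degree v = 2) {a b : α} (h : G.Adj a b) :
    ∃ q : G.Walk b a, q.IsHamiltonian ∧ ∀ f ∈ G.edgeSet, f ≠ s(a, b) → f ∈ q.edges := by
  have hcyc : G.IsCycles := fun v _ ↦ by
    rw [← hreg v, ← G.card_neighborFinset_eq_degree, Set.ncard_eq_toFinset_card']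
    rfl
  obtain ⟨p₀, hp₀, hverts₀⟩ := hcyc.exists_cycle_toSubgraph_verts_eq_connectedComponentSupp
    (ConnectedComponent.connectedComponentMk_mem (v := a)) ⟨b, h⟩
  have hsupp (v : α) : v ∈ p₀.support := by
    rw [← Walk.mem_verts_toSubgraph, hverts₀, ConnectedComponent.mem_supp_iff]
    exact ConnectedComponent.sound (hconn.preconnected v a)
  have hadj {u v : α} (huv : G.Adj u v) : p₀.toSubgraph.Adj u v := by
    have heq : p₀.toSubgraph.neighborSet u = G.neighborSet u :=
      Set.eq_of_subset_of_ncard_le (p₀.toSubgraph.neighborSet_subset u) (by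
        rw [hcyc ⟨v, huv⟩, hp₀.ncard_neighborSet_toSubgraph_eq_two (hsupp u)])
    exact heq.symm.subset huv
  obtain ⟨p, hp, hsnd, hverts⟩ := hp₀.exists_isCycle_snd_verts_eq (hadj h)
  have hmem (v : α) : v ∈ p.support := by
    rw [← Walk.mem_verts_toSubgraph, hverts, Walk.mem_verts_toSubgraph]
    exact hsupp v
  have hadj' {u v : α} (huv : G.Adj u v) : s(u, v) ∈ p.edges := by
    have heq : p.toSubgraph.neighborSet u = G.neighborSet u :=
      Set.eq_of_subset_of_ncard_le (p.toSubgraph.neighborSet_subset u) (by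
        rw [hcyc ⟨v, huv⟩, hp.ncard_neighborSet_toSubgraph_eq_two (hmem u)])
    exact Walk.adj_toSubgraph_iff_mem_edges.1 (heq.symm.subset huv)
  cases p with
  | nil => simp at hp
  | cons h' q =>
    obtain rfl : _ = b := by simpa using hsnd
    have hq := (Walk.cons_isCycle_iff _ _).1 hp
    refine ⟨q, hq.1.isHamiltonian_of_mem fun w ↦ ?_, fun f hf hne ↦ ?_⟩
    · rcases List.mem_cons.1 (Walk.support_cons h' q ▸ hmem w) with rfl | hw
      exacts [q.end_mem_support, hw]
    · induction f with | _ u v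
      have := hadj' hf
      rw [Walk.edges_cons] at this
      exact (List.mem_cons.1 this).resolve_left hne

/-- A Hamiltonian path whose ends are adjacent closes up to a Hamiltonian cycle. -/
lemma Walk.IsHamiltonian.isHamiltonianCycle_cons {a b : α} {q : G.Walk b a}
    (hq : q.IsHamiltonian) (hlen : 2 ≤ q.length) (h : G.Adj a b) :
    (Walk.cons h q).IsHamiltonianCycle := by
  rw [Walk.isHamiltonianCycle_iff_isCycle_and_support_count_tail_eq_one]
  refine ⟨(Walk.cons_isCycle_iff _ _).2 ⟨hq.isPath, fun hmem ↦ ?_⟩, hq⟩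
  have := hq.isPath.length_eq_one_of_mem_edges (Sym2.eq_swap ▸ hmem)
  omega

/-- A Hamiltonian path of `G` traversed in both layers of the prism over `G`. -/
lemma exists_isHamiltonianCycle_boxProd_of_isHamiltonian {a b : α} {q : G.Walk b a}
    (hq : q.IsHamiltonian) (hlen : 1 ≤ q.length) :
    ∃ (x : α × Fin 2) (p : (G □ (⊤ : SimpleGraph (Fin 2))).Walk x x), p.IsHamiltonianCycle ∧
      s((a, (0 : Fin 2)), (a, 1)) ∈ p.edges ∧ s((b, (0 : Fin 2)), (b, 1)) ∈ p.edges ∧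
      ∀ u v (i : Fin 2), s(u, v) ∈ q.edges → s((u, i), (v, i)) ∈ p.edges := by
  let layer (i : Fin 2) := (G.boxProdLeft (⊤ : SimpleGraph (Fin 2)) i).toHom
  have ha : (G □ (⊤ : SimpleGraph (Fin 2))).Adj (layer 0 a) (layer 1 a) := by simp [layer]
  have hb : (G □ (⊤ : SimpleGraph (Fin 2))).Adj (layer 1 b) (layer 0 b) := by simp [layer]
  let w := (q.map (layer 0)).append (Walk.cons ha (q.map (layer 1)).reverse)
  have hcount (i j : Fin 2) (v : α) :
      (q.support.map (layer i)).count (v, j) = if i = j then 1 else 0 := by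
    split_ifs with hij
    · subst hij
      exact (List.count_map_of_injective _ _
        (G.boxProdLeft (⊤ : SimpleGraph (Fin 2)) i).injective v).trans (hq v)
    · refine List.count_eq_zero.2 fun hmem ↦ ?_
      obtain ⟨u, -, hu⟩ := List.mem_map.1 hmem
      exact hij (congrArg Prod.snd hu)
  have hw : w.IsHamiltonian := by
    rintro ⟨v, j⟩
    simp only [w, Walk.support_append, Walk.support_cons, List.tail_cons, Walk.support_reverse,
      Walk.support_map, List.count_append, List.count_reverse]
    have h₀ := hcount 0 j v
    have h₁ := hcount 1 j v
    rw [lawful_beq_subsingleton instBEqProd instBEqOfDecidableEq] at h₀ h₁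
    rw [h₀, h₁]
    fin_cases j <;> simp
  refine ⟨_, _, hw.isHamiltonianCycle_cons (by simp [w]; omega) hb, ?_, ?_, fun u v i huv ↦ ?_⟩
  · simp [w, layer]
  · simp [w, layer]
  · have : s((u, i), (v, i)) ∈ (q.map (layer i)).edges := by
      rw [Walk.edges_map]
      exact List.mem_map_of_mem (f := Sym2.map (layer i)) huv
    fin_cases i
    · simp only [w, Walk.edges_cons, Walk.edges_append, Walk.edges_reverse]
      exact List.mem_cons_of_mem _ (List.mem_append_left _ this)
    · simp only [w, Walk.edges_cons, Walk.edges_append, Walk.edges_reverse]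
      exact List.mem_cons_of_mem _ (List.mem_append_right _ (List.mem_cons_of_mem _
        (List.mem_reverse.2 this)))

/-- The walk in the prism over `G` that follows `q` and crosses between the layers at each of its
vertices. -/
lemma exists_walk_boxProd_zigzag {a b : α} (q : G.Walk b a) (i : Fin 2) :
    ∃ w : (G □ (⊤ : SimpleGraph (Fin 2))).Walk (b, i) (a, i + 1 + Fin.ofNat 2 q.length),
      w.length = 2 * q.length + 1 ∧
      (∀ v j, w.support.count (v, j) = q.support.count v) ∧
      ∀ v ∈ q.support, s((v, (0 : Fin 2)), (v, 1)) ∈ w.edges := by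
  induction q generalizing i with
  | nil =>
    rename_i b
    have h : (G □ (⊤ : SimpleGraph (Fin 2))).Adj (b, i) (b, i + 1) := by
      fin_cases i <;> simp
    refine ⟨(Walk.cons h Walk.nil).copy rfl (by simp), Walk.length_copy .., fun v j ↦ ?_, fun v hv ↦ ?_⟩
    · fin_cases i <;> fin_cases j <;> by_cases hv : b = v <;> simp [hv]
    · obtain rfl : v = b := by simpa using hv
      fin_cases i <;> simp
  | @cons b c a hbc q ih =>
    obtain ⟨w, hlength, hcount, hedges⟩ := ih (i + 1)
    have h : (G □ (⊤ : SimpleGraph (Fin 2))).Adj (b, i) (b, i + 1) := by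
      fin_cases i <;> simp
    have h' : (G □ (⊤ : SimpleGraph (Fin 2))).Adj (b, i + 1) (c, i + 1) := by simp [hbc]
    refine ⟨(Walk.cons h (Walk.cons h' w)).copy rfl ?_, ?_, fun v j ↦ ?_, fun v hv ↦ ?_⟩
    · ext
      · rfl
      · simp [Fin.val_add]
        omega
    · rw [Walk.length_copy, Walk.length_cons, Walk.length_cons, Walk.length_cons, hlength]
      omega
    · simp only [Walk.support_copy, Walk.support_cons, List.count_cons, hcount]
      fin_cases i <;> fin_cases j <;> by_cases hv : b = v <;> simp [hv]
    · simp only [Walk.edges_copy, Walk.edges_cons]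
      rcases List.mem_cons.1 (Walk.support_cons hbc q ▸ hv) with rfl | hv
      · fin_cases i <;> simp
      · exact List.mem_cons_of_mem _ (List.mem_cons_of_mem _ (hedges v hv))

/-- A Hamiltonian cycle of even length in `G` gives a Hamiltonian cycle of the prism over `G`
through all the vertical edges. -/
lemma exists_isHamiltonianCycle_boxProd_of_odd_length {a b : α} {q : G.Walk b a}
    (hq : q.IsHamiltonian) (hlen : Odd q.length) (h : G.Adj a b) :
    ∃ (x : α × Fin 2) (p : (G □ (⊤ : SimpleGraph (Fin 2))).Walk x x), p.IsHamiltonianCycle ∧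
      ∀ v, s((v, (0 : Fin 2)), (v, 1)) ∈ p.edges := by
  obtain ⟨w, hlength, hcount, hedges⟩ := exists_walk_boxProd_zigzag q 0
  have hend : (0 : Fin 2) + 1 + Fin.ofNat 2 q.length = 0 := by
    obtain ⟨k, hk⟩ := hlen
    ext
    simp [Fin.val_add]
    omega
  have hw : w.IsHamiltonian := by
    rintro ⟨v, j⟩
    have := (hcount v j).trans (hq v)
    rwa [lawful_beq_subsingleton instBEqProd instBEqOfDecidableEq] at this
  have hclose : (G □ (⊤ : SimpleGraph (Fin 2))).Adj
      (a, 0 + 1 + Fin.ofNat 2 q.length) (b, 0) := by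
    rw [hend]
    exact boxProd_adj_left.2 h
  refine ⟨_, _, hw.isHamiltonianCycle_cons ?_ hclose, fun v ↦ ?_⟩
  · have := hlen.pos
    omega
  · exact List.mem_cons_of_mem _ (hedges v (hq.mem_support v))

omit [DecidableEq α] in
/-- The edges of the prism over `G` are the vertical ones and the copies of the edges of `G`. -/
lemma mem_edgeSet_boxProd_top_fin_two {e : Sym2 (α × Fin 2)}
    (he : e ∈ (G □ (⊤ : SimpleGraph (Fin 2))).edgeSet) :
    (∃ v, e = s((v, (0 : Fin 2)), (v, 1))) ∨
      ∃ u v i, G.Adj u v ∧ e = s((u, i), (v, i)) := by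
  induction e with | _ x y
  obtain ⟨u, i⟩ := x
  obtain ⟨v, j⟩ := y
  rw [mem_edgeSet, boxProd_adj] at he
  obtain ⟨huv, rfl : i = j⟩ | ⟨hij, rfl : u = v⟩ := he
  · exact Or.inr ⟨u, v, i, huv, rfl⟩
  · refine Or.inl ⟨u, ?_⟩
    fin_cases i <;> fin_cases j <;> simp at hij ⊢

end SimpleGraph

/-- Let `C` be a cycle graph (connected 2-regular) on `m ≥ 3` vertices
and `K₂` the complete graph on the two vertices `0, 1` of `Fin 2`. If two edges `e, e'`
of `C □ K₂` are not both vertical, or are vertical over adjacent vertices of `C`, or `m`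
is even, then `C □ K₂` has a Hamiltonian cycle containing both `e` and `e'`. -/
theorem boxProd_cycle_edge_hamiltonian {α : Type*} [Fintype α] [DecidableEq α]
    (C : SimpleGraph α) [DecidableRel C.Adj]
    (m : ℕ) (hm : 3 ≤ m) (hcard : Fintype.card α = m)
    (hconn : C.Connected) (hreg : ∀ v, C.degree v = 2)
    (e e' : Sym2 (α × Fin 2))
    (he : e ∈ (C □ (⊤ : SimpleGraph (Fin 2))).edgeSet)
    (he' : e' ∈ (C □ (⊤ : SimpleGraph (Fin 2))).edgeSet)
    (hcond :
      (¬ ((∃ v, e = s((v, (0 : Fin 2)), (v, 1))) ∧ (∃ v, e' = s((v, (0 : Fin 2)), (v, 1))))) ∨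
      (∃ v v', C.Adj v v' ∧ e = s((v, (0 : Fin 2)), (v, 1)) ∧
        e' = s((v', (0 : Fin 2)), (v', 1))) ∨
      Even m) :
    ∃ (a : α × Fin 2) (p : (C □ (⊤ : SimpleGraph (Fin 2))).Walk a a),
      p.IsHamiltonianCycle ∧ e ∈ p.edges ∧ e' ∈ p.edges := by
  have htwo {v : α} (f : Sym2 α) : ∃ w, C.Adj v w ∧ f ≠ s(v, w) := by
    obtain ⟨x, y, hxy, heq⟩ := Finset.card_eq_two.1 (hreg v)
    have hx : C.Adj v x := by rw [← mem_neighborFinset, heq]; simp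
    have hy : C.Adj v y := by rw [← mem_neighborFinset, heq]; simp
    by_cases hf : f = s(v, x)
    · exact ⟨y, hy, fun h ↦ hxy (Sym2.congr_right.1 (hf.symm.trans h))⟩
    · exact ⟨x, hx, hf⟩
  have hthree (f f' : Sym2 α) : ∃ a b, C.Adj a b ∧ f ≠ s(a, b) ∧ f' ≠ s(a, b) := by
    have hsum := C.sum_degrees_eq_twice_card_edges
    simp only [hreg, Finset.sum_const, Finset.card_univ, hcard, smul_eq_mul] at hsum
    have hlt : ({f, f'} : Finset (Sym2 α)).card < C.edgeFinset.card :=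
      Finset.card_le_two.trans_lt (by omega)
    obtain ⟨g, hg, hgn⟩ := Finset.exists_mem_notMem_of_card_lt_card hlt
    induction g with | _ a b
    simp only [Finset.mem_insert, Finset.mem_singleton, not_or] at hgn
    exact ⟨a, b, by simpa using hg, Ne.symm hgn.1, Ne.symm hgn.2⟩
  have hlayers {a b : α} (h : C.Adj a b) :
      ∃ (x : α × Fin 2) (p : (C □ (⊤ : SimpleGraph (Fin 2))).Walk x x), p.IsHamiltonianCycle ∧
        s((a, (0 : Fin 2)), (a, 1)) ∈ p.edges ∧ s((b, (0 : Fin 2)), (b, 1)) ∈ p.edges ∧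
        ∀ u v (i : Fin 2), C.Adj u v → s(u, v) ≠ s(a, b) → s((u, i), (v, i)) ∈ p.edges := by
    obtain ⟨q, hq, hedges⟩ := exists_isHamiltonian_of_adj hconn hreg h
    obtain ⟨x, p, hp, h₁, h₂, h₃⟩ := exists_isHamiltonianCycle_boxProd_of_isHamiltonian hq
      (by rw [hq.length_eq]; omega)
    exact ⟨x, p, hp, h₁, h₂, fun u v i huv hne ↦ h₃ u v i (hedges _ huv hne)⟩
  obtain ⟨v, rfl⟩ | ⟨u, v, i, huv, rfl⟩ := mem_edgeSet_boxProd_top_fin_two he <;>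
    obtain ⟨v', rfl⟩ | ⟨u', v', i', huv', rfl⟩ := mem_edgeSet_boxProd_top_fin_two he'
  · obtain hne | ⟨w, w', hww', hw, hw'⟩ | hm_even := hcond
    · exact absurd ⟨⟨v, rfl⟩, ⟨v', rfl⟩⟩ hne
    · obtain ⟨x, p, hp, h₁, h₂, -⟩ := hlayers hww'
      exact ⟨x, p, hp, hw ▸ h₁, hw' ▸ h₂⟩
    · obtain ⟨w, hw, -⟩ := htwo (v := v) s(v, v)
      obtain ⟨q, hq, -⟩ := exists_isHamiltonian_of_adj hconn hreg hw
      obtain ⟨x, p, hp, hvert⟩ := exists_isHamiltonianCycle_boxProd_of_odd_length hq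
        (by rw [hq.length_eq, hcard]; exact Nat.Even.sub_odd (by omega) hm_even odd_one) hw
      exact ⟨x, p, hp, hvert v, hvert v'⟩
  · obtain ⟨w, hw, hne⟩ := htwo (v := v) s(u', v')
    obtain ⟨x, p, hp, h₁, -, h₃⟩ := hlayers hw
    exact ⟨x, p, hp, h₁, h₃ u' v' i' huv' hne⟩
  · obtain ⟨w, hw, hne⟩ := htwo (v := v') s(u, v)
    obtain ⟨x, p, hp, h₁, -, h₃⟩ := hlayers hw
    exact ⟨x, p, hp, h₃ u v i huv hne, h₁⟩
  · obtain ⟨a, b, hab, hne, hne'⟩ := hthree s(u, v) s(u', v')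
    obtain ⟨x, p, hp, -, -, h₃⟩ := hlayers hab
    exact ⟨x, p, hp, h₃ u v i huv hne, h₃ u' v' i' huv' hne'⟩
end

section
/- Let G be a connected finite simple graph with at least 5 vertices that is not a star (i.e., there is no vertex contained in every edge of G). Let D be the set of 2-element vertex subsets {x, y} such that the graph G ∖ {x, y} obtained by deleting x and y has no edge. Then |D| ≤ 2, and any two elements of D have a vertex in common. -/
open Finset

open scoped Classical

variable {V : Type*} [Fintype V] [DecidableEq V]

/-- The set `D` of totally disconnecting pairs of `G`: 2-element vertex subsets `{x, y}`
such that deleting `x` and `y` from `G` leaves no edge, i.e. every edge of `G` meets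
`{x, y}`. -/
noncomputable def totDisc (G : SimpleGraph V) [DecidableRel G.Adj] : Finset (Finset V) :=
  (Finset.univ.powersetCard 2).filter fun p => ∀ e ∈ G.edgeFinset, ∃ v ∈ p, v ∈ e

theorem mem_totDisc_iff (G : SimpleGraph V) [DecidableRel G.Adj] (p : Finset V) :
    p ∈ totDisc G ↔ p.card = 2 ∧ ∀ u v, G.Adj u v → u ∈ p ∨ v ∈ p := by
  simp only [totDisc, mem_filter, mem_powersetCard_univ, SimpleGraph.mem_edgeFinset]
  refine and_congr_right fun _ => ⟨fun h u v huv => ?_, fun h e => ?_⟩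
  · obtain ⟨w, hw, hwe⟩ := h s(u, v) huv
    rcases Sym2.mem_iff.1 hwe with rfl | rfl
    exacts [Or.inl hw, Or.inr hw]
  · induction e with
    | h u v =>
      intro huv
      rcases h u v huv with hu | hv
      exacts [⟨u, hu, Sym2.mem_mk_left u v⟩, ⟨v, hv, Sym2.mem_mk_right u v⟩]

theorem eq_pair_of_mem_of_card_eq_two {α : Type*} [DecidableEq α] {p : Finset α}
    (hp : p.card = 2) {w u : α} (hw : w ∈ p)
    (hu : u ∈ p) (hne : w ≠ u) : p = {w, u} :=
  (eq_of_subset_of_card_le (insert_subset hw (singleton_subset_iff.2 hu))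
    (by rw [hp, card_pair hne])).symm

/-- In a connected graph on at least 5 vertices, a set of at most 4 misses some vertex,
and any neighbour of that vertex lies in every vertex cover contained in the set. -/
theorem SimpleGraph.Connected.exists_mem_of_covers {G : SimpleGraph V} (hconn : G.Connected)
    (hcard : 5 ≤ Fintype.card V) {T : Finset V} (hT : T.card ≤ 4) :
    ∃ w, ∀ p ⊆ T, (∀ u v, G.Adj u v → u ∈ p ∨ v ∈ p) → w ∈ p := by
  obtain ⟨x, hx⟩ : ∃ x, x ∉ T := by
    by_contra! h
    have := card_le_card fun y (_ : y ∈ (univ : Finset V)) => h y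
    rw [card_univ] at this
    omega
  have : Nontrivial V := Fintype.one_lt_card_iff_nontrivial.1 (by omega)
  obtain ⟨w, hw⟩ := hconn.preconnected.exists_adj_of_nontrivial x
  exact ⟨w, fun p hp hcov => (hcov x w hw).resolve_left fun h => hx (hp h)⟩

/-- If `G` is connected with at least 5 vertices and is not a star,
then `G` has at most two totally disconnecting pairs, and any two of them share a
vertex. -/
theorem totDisc_card_le_two (G : SimpleGraph V) [DecidableRel G.Adj]
    (hconn : G.Connected) (hcard : 5 ≤ Fintype.card V)
    (hstar : ¬ ∃ c : V, ∀ e ∈ G.edgeSet, c ∈ e) :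
    (totDisc G).card ≤ 2 ∧ ∀ p ∈ totDisc G, ∀ q ∈ totDisc G, (p ∩ q).Nonempty := by
  have hmeet : ∀ p ∈ totDisc G, ∀ q ∈ totDisc G, (p ∩ q).Nonempty := by
    intro p hp q hq
    rw [mem_totDisc_iff] at hp hq
    obtain ⟨w, hw⟩ := hconn.exists_mem_of_covers hcard (T := p ∪ q)
      ((card_union_le p q).trans (by omega))
    exact ⟨w, mem_inter.2 ⟨hw p subset_union_left hp.2, hw q subset_union_right hq.2⟩⟩
  refine ⟨?_, hmeet⟩
  by_contra! hlt
  obtain ⟨p, hp, q, hq, r, hr, hpq, hpr, hqr⟩ := two_lt_card.1 hlt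
  have hcard_pq := card_pos.2 (hmeet p hp q hq)
  have hcard_pr := card_pos.2 (hmeet p hp r hr)
  rw [mem_totDisc_iff] at hp hq hr
  have hT : (p ∪ q ∪ r).card ≤ 4 := by
    have h₁ := card_union_add_card_inter p q
    have h₂ := card_union_add_card_inter (p ∪ q) r
    have h₃ : (p ∩ r).card ≤ ((p ∪ q) ∩ r).card :=
      card_le_card (inter_subset_inter_right subset_union_left)
    omega
  obtain ⟨w, hw⟩ := hconn.exists_mem_of_covers hcard hT
  have hwp := hw p (subset_union_left.trans subset_union_left) hp.2
  have hwq := hw q (subset_union_right.trans subset_union_left) hq.2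
  have hwr := hw r subset_union_right hr.2
  refine hstar ⟨w, fun e => ?_⟩
  induction e with
  | h u v =>
    intro huv
    by_contra hwe
    obtain ⟨hwu, hwv⟩ : w ≠ u ∧ w ≠ v := by simpa using hwe
    have hpair : ∀ s : Finset V, s.card = 2 ∧ (∀ u v, G.Adj u v → u ∈ s ∨ v ∈ s) → w ∈ s →
        s = {w, u} ∨ s = {w, v} := fun s hs hws =>
      (hs.2 u v huv).imp (fun h => eq_pair_of_mem_of_card_eq_two hs.1 hws h hwu)
        fun h => eq_pair_of_mem_of_card_eq_two hs.1 hws h hwv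
    rcases hpair p hp hwp with h₁ | h₁ <;> rcases hpair q hq hwq with h₂ | h₂ <;>
      rcases hpair r hr hwr with h₃ | h₃ <;> simp_all
end
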